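/- arXiv:2103.05488 — 2 statements merged into one kernel-verified Lean document; each statement's English description precedes it below -/
import Mathlib

section
/- For every integer $c\geq 1$ and every real $\psi$ with $0\leq\psi\leq\frac{\pi}{2}$, one has $\left(\cos\frac{\psi}{\sqrt{c}}\right)^c\geq\cos\psi$. -/
/-- For `1 ≤ s`, the inequality `s * tan (x / s) ≤ tan x` on `[0, π / 2)`, with denominators
cleared so that it holds on `[0, π]`. -/
theorem mul_sin_div_mul_cos_le {s x : ℝ} (hs : 1 ≤ s) (hx0 : 0 ≤ x) (hx : x ≤ Real.pi) :
    s * Real.sin (x / s) * Real.cos x ≤ Real.sin x * Real.cos (x / s) := by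
  have hs0 : 0 < s := by linarith
  have hderiv (y : ℝ) : HasDerivAt
      (fun y => Real.sin y * Real.cos (y / s) - s * Real.sin (y / s) * Real.cos y)
      ((s - 1 / s) * (Real.sin y * Real.sin (y / s))) y := by
    have hd : HasDerivAt (fun y : ℝ => y / s) (1 / s) y := (hasDerivAt_id y).div_const s
    refine (((Real.hasDerivAt_sin y).mul hd.cos).sub
      ((hd.sin.const_mul s).mul (Real.hasDerivAt_cos y))).congr_deriv ?_
    field_simp
    ring
  have hmono : MonotoneOn
      (fun y => Real.sin y * Real.cos (y / s) - s * Real.sin (y / s) * Real.cos y)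
      (Set.Icc 0 Real.pi) := by
    refine monotoneOn_of_hasDerivWithinAt_nonneg (convex_Icc _ _)
      (fun y _ => (hderiv y).continuousAt.continuousWithinAt)
      (fun y _ => (hderiv y).hasDerivWithinAt) fun y hy => ?_
    rw [interior_Icc] at hy
    have hys : y / s ≤ y := div_le_self hy.1.le hs
    have hinv : 1 / s ≤ 1 := (div_le_one hs0).2 hs
    exact mul_nonneg (by linarith)
      (mul_nonneg (Real.sin_nonneg_of_nonneg_of_le_pi hy.1.le hy.2.le)
        (Real.sin_nonneg_of_nonneg_of_le_pi (div_nonneg hy.1.le hs0.le) (hys.trans hy.2.le)))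
  have h := hmono (Set.left_mem_Icc.2 Real.pi_pos.le) ⟨hx0, hx⟩ hx0
  simp only [Real.sin_zero, zero_div, zero_mul, mul_zero, sub_zero] at h
  linarith

/-- Inequality (3.2.3): `(cos(ψ/√c))^c ≥ cos ψ` for `0 ≤ ψ ≤ π/2` and integer `c ≥ 1`. -/
theorem cos_div_sqrt_pow_ge_cos
    (c : ℕ) (hc : 1 ≤ c) (ψ : ℝ) (hψ0 : 0 ≤ ψ) (hψ : ψ ≤ Real.pi / 2) :
    Real.cos ψ ≤ (Real.cos (ψ / Real.sqrt c)) ^ c := by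
  obtain rfl | hc1 := hc.eq_or_lt
  · simp
  set s := Real.sqrt c with hs_def
  have hs : 1 < s := by
    rw [hs_def, Real.lt_sqrt zero_le_one]
    exact_mod_cast (by simpa using hc1)
  have hs0 : 0 < s := by linarith
  have hsq : (c : ℝ) = s * s := (Real.mul_self_sqrt (Nat.cast_nonneg c)).symm
  have hpos (y : ℝ) (hy : y ∈ Set.Icc 0 (Real.pi / 2)) : 0 < Real.cos (y / s) := by
    have h1 : Real.pi / 2 / s < Real.pi / 2 := div_lt_self (by positivity) hs
    have h2 : y / s ≤ Real.pi / 2 / s := div_le_div_of_nonneg_right hy.2 hs0.le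
    have h3 : 0 ≤ y / s := div_nonneg hy.1 hs0.le
    exact Real.cos_pos_of_mem_Ioo ⟨by linarith [Real.pi_pos], by linarith⟩
  have hderiv (y : ℝ) (hy : y ∈ Set.Icc 0 (Real.pi / 2)) : HasDerivAt
      (fun y => Real.cos y / Real.cos (y / s) ^ c)
      (Real.cos (y / s) ^ (c - 1) *
        (s * Real.sin (y / s) * Real.cos y - Real.sin y * Real.cos (y / s)) /
        (Real.cos (y / s) ^ c) ^ 2) y := by
    have hd : HasDerivAt (fun y : ℝ => y / s) (1 / s) y := (hasDerivAt_id y).div_const s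
    refine ((Real.hasDerivAt_cos y).div (hd.cos.pow c) (pow_pos (hpos y hy) c).ne').congr_deriv ?_
    simp only [Pi.pow_apply]
    congr 1
    rw [hsq, ← pow_sub_one_mul (by omega : c ≠ 0) (Real.cos (y / s))]
    field_simp
    ring
  have hanti : AntitoneOn (fun y => Real.cos y / Real.cos (y / s) ^ c)
      (Set.Icc 0 (Real.pi / 2)) := by
    refine antitoneOn_of_hasDerivWithinAt_nonpos (convex_Icc _ _)
      (fun y hy => (hderiv y hy).continuousAt.continuousWithinAt)
      (fun y hy => (hderiv y (interior_subset hy)).hasDerivWithinAt) fun y hy => ?_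
    have hy' := interior_subset hy
    refine div_nonpos_of_nonpos_of_nonneg (mul_nonpos_of_nonneg_of_nonpos
      (pow_nonneg (hpos y hy').le _) (sub_nonpos.2 ?_)) (sq_nonneg _)
    exact mul_sin_div_mul_cos_le hs.le hy'.1 (by linarith [hy'.2, Real.pi_pos])
  have h := hanti (Set.left_mem_Icc.2 (by positivity)) ⟨hψ0, hψ⟩ hψ0
  simpa [div_le_one (pow_pos (hpos ψ ⟨hψ0, hψ⟩) c)] using h
end

section
/- For real numbers $\alpha_{ij}$ ($i=1,\dots,m$, $j=1,\dots,n$), complex numbers $z_1,\dots,z_n$, and any $\xi_1,\dots,\xi_n\in\{0,1\}$, the following identity holds: $2^m\sum_{\xi_1,\dots,\xi_n\in\{0,1\}} z_1^{\xi_1}\cdots z_n^{\xi_n}\prod_{i=1}^m\cos\left(\sum_{j=1}^n \alpha_{ij}\xi_j\right)=\sum_{\sigma_1,\dots,\sigma_m=\pm 1}\prod_{j=1}^n\left(1+z_j\exp\left\{\sqrt{-1}\sum_{i=1}^m \alpha_{ij}\sigma_i\right\}\right)$. -/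
/-- Summing the characters `exp(√-1 ∑ᵢ θᵢσᵢ)` over all signs `σ` factors into cosines. -/
theorem sum_exp_sign_eq_prod_cos {ι : Type*} [Fintype ι] [DecidableEq ι] (θ : ι → ℝ) :
    ∑ σ : ι → Bool, Complex.exp (Complex.I *
        ((∑ i, θ i * (if σ i then (1 : ℝ) else -1) : ℝ) : ℂ)) =
      2 ^ Fintype.card ι * ∏ i, (Real.cos (θ i) : ℂ) := by
  have h_cos (i : ι) : (2 : ℂ) * (Real.cos (θ i) : ℂ) =
      ∑ b : Bool, Complex.exp (Complex.I * ((θ i * (if b then (1 : ℝ) else -1) : ℝ) : ℂ)) := by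
    rw [Complex.ofReal_cos, Complex.two_cos]
    simp [mul_comm]
  rw [← Finset.card_univ, ← Finset.prod_const, ← Finset.prod_mul_distrib,
    Finset.prod_congr rfl fun i _ => h_cos i, Finset.prod_univ_sum, Fintype.piFinset_univ]
  refine Finset.sum_congr rfl fun σ _ => ?_
  rw [← Complex.exp_sum, Complex.ofReal_sum, Finset.mul_sum]

/-- The Fourier duality identity:
`2^m ∑_{ξ ∈ {0,1}ⁿ} z^ξ ∏ᵢ cos(∑ⱼ αᵢⱼξⱼ)
  = ∑_{σ ∈ {-1,1}ᵐ} ∏ⱼ (1 + zⱼ exp{√-1 ∑ᵢ αᵢⱼσᵢ})`. -/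
theorem fourier_duality_identity
    (m n : ℕ) (α : Fin m → Fin n → ℝ) (z : Fin n → ℂ) :
    (2 : ℂ) ^ m * ∑ ξ : Fin n → Fin 2, (∏ j, z j ^ (ξ j : ℕ)) *
        ∏ i, (↑(Real.cos (∑ j, α i j * ((ξ j : ℕ) : ℝ))) : ℂ) =
      ∑ σ : Fin m → Bool, ∏ j,
        (1 + z j * Complex.exp (Complex.I *
          (↑(∑ i, α i j * (if σ i then (1 : ℝ) else -1)) : ℂ))) := by
  have h_expand (w : Fin n → ℂ) : ∏ j, (1 + w j) = ∑ ξ : Fin n → Fin 2, ∏ j, w j ^ (ξ j : ℕ) := by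
    rw [← Fintype.piFinset_univ,
      ← Finset.prod_univ_sum (fun _ => Finset.univ) fun j (k : Fin 2) => w j ^ (k : ℕ)]
    simp
  simp_rw [h_expand, mul_pow, Finset.prod_mul_distrib]
  rw [Finset.sum_comm, Finset.mul_sum]
  refine Finset.sum_congr rfl fun ξ _ => ?_
  have h_sum := sum_exp_sign_eq_prod_cos fun i => ∑ j, α i j * ((ξ j : ℕ) : ℝ)
  rw [Fintype.card_fin] at h_sum
  rw [← Finset.mul_sum, mul_left_comm, ← h_sum]
  congr 1
  refine Finset.sum_congr rfl fun σ _ => ?_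
  simp_rw [← Complex.exp_nat_mul]
  rw [← Complex.exp_sum]
  congr 1
  push_cast
  simp_rw [Finset.mul_sum, Finset.sum_mul, Finset.mul_sum]
  rw [Finset.sum_comm]
  refine Finset.sum_congr rfl fun j _ => Finset.sum_congr rfl fun i _ => ?_
  ring
end
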